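/- arXiv:2305.14229 — 2 statements merged into one kernel-verified Lean document; each statement's English description precedes it below -/
import Mathlib

section
/- Let f : Z → X be a diffeomorphism that is compositional and irreducible. Suppose ĝ : X → Z and f̂ : Z → X are differentiable maps such that for every z ∈ Z, f̂(ĝ(f(z))) = f(z) and the compositional contrast satisfies C(f̂, ĝ(f(z))) = 0. Then ĝ slot-identifies z: for every k ∈ [K] there exist a unique j ∈ [K] and a diffeomorphism h_k : ℝ^M → ℝ^M such that the j-th slot of ĝ(f(z)) equals h_k(z_k) for all z ∈ Z. -/
open Function Set

/-- A latent slot space `ℝ^M`. -/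
abbrev SlotSp (M : ℕ) := Fin M → ℝ

/-- The latent space `Z = (ℝ^M)^K`. -/
abbrev LatSp (K M : ℕ) := Fin K → SlotSp M

/-- The observation space `X = ℝ^N`. -/
abbrev ObsSp (N : ℕ) := Fin N → ℝ

/-- A diffeomorphism: a differentiable bijection with differentiable inverse. -/
def IsDiffeo {E F : Type*} [NormedAddCommGroup E] [NormedSpace ℝ E]
    [NormedAddCommGroup F] [NormedSpace ℝ F] (f : E → F) : Prop :=
  Differentiable ℝ f ∧
    ∃ g : F → E, Differentiable ℝ g ∧ Function.LeftInverse g f ∧ Function.RightInverse g f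

/-- The partial derivative `∂f_n/∂z_k(z)` of the `n`-th component of `f` with respect to
the `k`-th latent slot at `z`, viewed as a (linear) map `ℝ^M → ℝ`. -/
noncomputable def slotDeriv {K M N : ℕ} (f : LatSp K M → ObsSp N) (z : LatSp K M)
    (n : Fin N) (k : Fin K) : SlotSp M → ℝ :=
  fun v => fderiv ℝ f z (Pi.single k v) n

/-- `I_k(z)`: the set of pixels whose value depends on the `k`-th slot at `z`. -/
def Iset {K M N : ℕ} (f : LatSp K M → ObsSp N) (z : LatSp K M) (k : Fin K) : Set (Fin N) :=
  {n | slotDeriv f z n k ≠ 0}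

/-- `f` is compositional: each pixel depends on at most one slot. -/
def Compositional {K M N : ℕ} (f : LatSp K M → ObsSp N) : Prop :=
  ∀ z : LatSp K M, ∀ k j : Fin K, k ≠ j → Iset f z k ∩ Iset f z j = ∅

/-- `rank(Jf_S(z))`: the rank of the Jacobian of `f` at `z` restricted to the rows `S`. -/
noncomputable def jacRank {K M N : ℕ} (f : LatSp K M → ObsSp N) (z : LatSp K M)
    (S : Set (Fin N)) : ℕ :=
  Module.finrank ℝ
    (LinearMap.range ((LinearMap.funLeft ℝ ℝ ((↑) : S → Fin N)).comp
      (fderiv ℝ f z).toLinearMap))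

/-- The sub-mechanisms `Jf_{S1}(z)` and `Jf_{S2}(z)` are independent. -/
def IndepSub {K M N : ℕ} (f : LatSp K M → ObsSp N) (z : LatSp K M) (S1 S2 : Set (Fin N)) : Prop :=
  jacRank f z (S1 ∪ S2) = jacRank f z S1 + jacRank f z S2

/-- The sub-mechanisms `Jf_{S1}(z)` and `Jf_{S2}(z)` are dependent. -/
def DepSub {K M N : ℕ} (f : LatSp K M → ObsSp N) (z : LatSp K M) (S1 S2 : Set (Fin N)) : Prop :=
  jacRank f z (S1 ∪ S2) < jacRank f z S1 + jacRank f z S2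

/-- `f` has irreducible mechanisms: no mechanism can be partitioned into two
independent sub-mechanisms. -/
def IrreducibleMech {K M N : ℕ} (f : LatSp K M → ObsSp N) : Prop :=
  ∀ (z : LatSp K M) (k : Fin K) (S1 S2 : Set (Fin N)),
    S1.Nonempty → S2.Nonempty → S1 ∪ S2 = Iset f z k → S1 ∩ S2 = ∅ →
      DepSub f z S1 S2

/-- The `M × M` Jacobian block `∂h_j/∂z_i(z)` of a map `h : Z → Z`, giving the derivative
of the `j`-th output slot with respect to the `i`-th input slot at `z`. -/
noncomputable def slotBlock {K M : ℕ} (h : LatSp K M → LatSp K M) (z : LatSp K M)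
    (j i : Fin K) : SlotSp M → SlotSp M :=
  fun v => fderiv ℝ h z (Pi.single i v) j

/-- `gHat` slot-identifies `z = f⁻¹(x)`: for every ground-truth slot `k` there are a
unique slot index `j` and a diffeomorphism `h` with `(gHat (f z))_j = h (z_k)` for all `z`. -/
def SlotIdentifies {K M N : ℕ} (f : LatSp K M → ObsSp N) (gHat : ObsSp N → LatSp K M) : Prop :=
  ∀ k : Fin K, ∃! j : Fin K, ∃ h : SlotSp M → SlotSp M,
    IsDiffeo h ∧ ∀ z : LatSp K M, gHat (f z) j = h (z k)

/-- The Euclidean norm `‖∂f_n/∂z_k(z)‖` of the gradient of the `n`-th component of `f`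
with respect to the `k`-th slot at `z`. -/
noncomputable def slotGradNorm {K M N : ℕ} (f : LatSp K M → ObsSp N) (z : LatSp K M)
    (n : Fin N) (k : Fin K) : ℝ :=
  Real.sqrt (∑ i : Fin M, (fderiv ℝ f z (Pi.single k (Pi.single i (1 : ℝ))) n) ^ 2)

/-- The compositional contrast `C(f, z)`. -/
noncomputable def Ccomp {K M N : ℕ} (f : LatSp K M → ObsSp N) (z : LatSp K M) : ℝ :=
  ∑ n : Fin N, ∑ k : Fin K, ∑ j : Fin K,
    if k < j then slotGradNorm f z n k * slotGradNorm f z n j else 0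


lemma line_sign {E : Type*} [NormedAddCommGroup E] [NormedSpace ℝ E] (φ : E → ℝ)
    (hφ : Differentiable ℝ φ) (d : E) (hd : ∀ z, fderiv ℝ φ z d ≠ 0) (z : E) (t : ℝ)
    (h0 : 0 < fderiv ℝ φ z d) : 0 < fderiv ℝ φ (z + t • d) d := by
  have hder : ∀ s : ℝ, HasDerivAt (fun s : ℝ => φ (z + s • d)) (fderiv ℝ φ (z + s • d) d) s := by
    intro s
    have h1 : HasDerivAt (fun s : ℝ => z + s • d) d s := by
      simpa using ((hasDerivAt_id s).smul_const d).const_add z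
    exact (hφ (z + s • d)).hasFDerivAt.comp_hasDerivAt s h1
  rcases hasDerivWithinAt_forall_lt_or_forall_gt_of_forall_ne (s := (univ : Set ℝ)) (m := 0)
    convex_univ (fun s _ => (hder s).hasDerivWithinAt) (fun s _ => hd _) with h | h
  · have := h 0 (mem_univ _)
    simp at this
    linarith
  · exact h t (mem_univ _)

lemma const_index {K : ℕ} (φ : LatSp K 1 → ℝ) (hφ : Differentiable ℝ φ)
    (H : ∀ z, ∃ i : Fin K, ∃ c : ℝ, c ≠ 0 ∧ ∀ d, fderiv ℝ φ z d = c * d i 0) :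
    ∃ i : Fin K, ∀ z, ∃ c : ℝ, c ≠ 0 ∧ ∀ d, fderiv ℝ φ z d = c * d i 0 := by
  obtain ⟨i, c, hc, hi⟩ := H 0
  refine ⟨i, fun z' => ?_⟩
  obtain ⟨i', c', hc', hi'⟩ := H z'
  by_cases hii : i' = i
  · exact ⟨c', hc', hii ▸ hi'⟩
  exfalso
  have hne : ∀ d : LatSp K 1, (∀ l, d l 0 ≠ 0) → ∀ z, fderiv ℝ φ z d ≠ 0 := by
    intro d hd z
    obtain ⟨l, a, ha, hl⟩ := H z
    rw [hl]
    exact mul_ne_zero ha (hd l)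
  let d : LatSp K 1 := fun l _ => if l = i then c else if l = i' then -c' else 1
  have hd : ∀ l, d l 0 ≠ 0 := by
    intro l
    simp only [d]
    split_ifs <;> simp [hc, hc']
  obtain ⟨T, hT⟩ : ∃ T : ℝ, ∀ l, 0 < (0 - z') l 0 * d l 0 + T * (d l 0 * d l 0) := by
    have : ∀ᶠ T : ℝ in Filter.atTop, ∀ l, 0 < (0 - z') l 0 * d l 0 + T * (d l 0 * d l 0) := by
      rw [Filter.eventually_all]
      intro l
      have : Filter.Tendsto (fun T : ℝ => (0 - z') l 0 * d l 0 + T * (d l 0 * d l 0))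
          Filter.atTop Filter.atTop :=
        Filter.tendsto_atTop_add_const_left _ _
          (Filter.tendsto_id.atTop_mul_const (mul_self_pos.2 (hd l)))
      exact this.eventually_gt_atTop 0
    exact this.exists
  have h1 : 0 < fderiv ℝ φ (0 + T • d) d := by
    apply line_sign φ hφ d (hne d hd)
    rw [hi]
    simp only [d, if_true]
    exact mul_self_pos.2 hc
  let d2 : LatSp K 1 := (0 + T • d) - z'
  have hd2 : ∀ l, 0 < d2 l 0 * d l 0 := by
    intro l
    have := hT l
    simp only [d2, Pi.sub_apply, Pi.add_apply, Pi.smul_apply, smul_eq_mul, Pi.zero_apply] at this ⊢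
    linarith
  have hd2' : ∀ l, d2 l 0 ≠ 0 := fun l h => by
    have := hd2 l
    simp [h] at this
  have h2 : 0 < fderiv ℝ φ (0 + T • d) d2 := by
    obtain ⟨l, a, ha, hl⟩ := H (0 + T • d)
    rw [hl] at h1 ⊢
    have h3 := mul_pos h1 (hd2 l)
    have h4 : a * d l 0 * (d2 l 0 * d l 0) = (a * d2 l 0) * (d l 0 * d l 0) := by ring
    rw [h4] at h3
    exact pos_of_mul_pos_left h3 (mul_self_nonneg _)
  have h3 := line_sign φ hφ d2 (hne d2 hd2') _ (-1) h2
  have h4 : 0 + T • d + (-1 : ℝ) • d2 = z' := by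
    simp only [d2]; module
  rw [h4, hi'] at h3
  have h5 := hd2 i'
  simp only [d, if_neg hii, if_true] at h5
  nlinarith

lemma surj_of_retract {E : Type*} [NormedAddCommGroup E] [NormedSpace ℝ E]
    [FiniteDimensional ℝ E] (ρ : E → E) (hρ : Continuous ρ) (hid : ∀ x, ρ (ρ x) = ρ x)
    (hd : ∀ x, HasFDerivAt ρ (ContinuousLinearMap.id ℝ E) (ρ x)) : ∀ x, ρ x = x := by
  have : ProperSpace E := FiniteDimensional.proper ℝ E
  intro p
  by_contra hp
  have hcl : IsClosed {x | ρ x = x} := isClosed_eq hρ continuous_id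
  obtain ⟨w, hw, hwd⟩ := hcl.exists_infDist_eq_dist ⟨ρ p, hid p⟩ p
  have hw' : ρ w = w := hw
  have hmin : ∀ y, dist p w ≤ dist p (ρ y) := fun y => by
    rw [← hwd]; exact Metric.infDist_le_dist_of_mem (hid y)
  have hpw : p ≠ w := fun h => hp (by rw [h, hw'])
  have hD : HasFDerivAt ρ (ContinuousLinearMap.id ℝ E) w := by
    have := hd w
    rwa [hw'] at this
  have hline : HasDerivAt (fun t : ℝ => ρ (w + t • (p - w))) (p - w) 0 := by
    have h1 : HasDerivAt (fun t : ℝ => w + t • (p - w)) (p - w) 0 := by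
      simpa using ((hasDerivAt_id (0:ℝ)).smul_const (p - w)).const_add w
    have := HasFDerivAt.comp_hasDerivAt (0:ℝ) (l := ρ) (l' := ContinuousLinearMap.id ℝ E) (by simpa using hD) h1
    exact this
  have hR : 0 < ‖p - w‖ := norm_pos_iff.2 (sub_ne_zero.2 hpw)
  rw [hasDerivAt_iff_isLittleO] at hline
  have hev := hline.def (c := ‖p - w‖ / 2) (by positivity)
  simp only [sub_zero, zero_smul, add_zero, hw'] at hev
  obtain ⟨t, ht, ht0, ht1⟩ : ∃ t : ℝ, ‖ρ (w + t • (p - w)) - w - t • (p - w)‖ ≤ ‖p - w‖ / 2 * ‖t‖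
      ∧ 0 < t ∧ t < 1 := by
    have h2 : ∀ᶠ t : ℝ in nhdsWithin 0 (Ioi 0), t ∈ Ioo (0:ℝ) 1 := Ioo_mem_nhdsGT one_pos
    obtain ⟨t, a, b⟩ := ((hev.filter_mono nhdsWithin_le_nhds).and h2).exists
    exact ⟨t, a, b.1, b.2⟩
  have h1 := hmin (w + t • (p - w))
  rw [dist_eq_norm, dist_eq_norm] at h1
  have h2 : p - ρ (w + t • (p - w)) = (1 - t) • (p - w) -
      (ρ (w + t • (p - w)) - w - t • (p - w)) := by module
  rw [h2] at h1
  have h3 := norm_sub_le ((1 - t) • (p - w)) (ρ (w + t • (p - w)) - w - t • (p - w))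
  rw [norm_smul, Real.norm_of_nonneg (by linarith : 0 ≤ 1 - t)] at h3
  rw [Real.norm_of_nonneg ht0.le] at ht
  nlinarith [mul_pos ht0 hR]

lemma jacRank_eq {K M N : ℕ} (f : LatSp K M → ObsSp N) (z : LatSp K M)
    (hs : Function.Surjective (fderiv ℝ f z)) (S : Set (Fin N)) : jacRank f z S = S.ncard := by
  classical
  unfold jacRank
  have : Function.Surjective ((LinearMap.funLeft ℝ ℝ ((↑) : S → Fin N)).comp
      (fderiv ℝ f z).toLinearMap) := by
    rw [LinearMap.coe_comp]
    exact (LinearMap.funLeft_surjective_of_injective ℝ ℝ _ Subtype.val_injective).comp hs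
  rw [LinearMap.range_eq_top.2 this, finrank_top, Module.finrank_fintype_fun_eq_card]
  rw [← Nat.card_coe_set_eq, Nat.card_eq_fintype_card]

lemma M_le_one {K M N : ℕ} (hK : 1 ≤ K) (f : LatSp K M → ObsSp N) (hfi : IrreducibleMech f)
    (hb : ∀ z, Function.Bijective (fderiv ℝ f z)) : M ≤ 1 := by
  let k : Fin K := ⟨0, hK⟩
  have hsub : (Iset f 0 k).Subsingleton := by
    intro a ha b hbb
    by_contra hab
    have := hfi 0 k {a} (Iset f 0 k \ {a}) ⟨a, rfl⟩ ⟨b, hbb, fun h => hab h.symm⟩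
      (by simp [ha]) (by simp)
    unfold DepSub at this
    simp only [jacRank_eq f 0 (hb 0).2] at this
    rw [Set.ncard_union_eq (by simp [Set.disjoint_sdiff_right]) (Set.toFinite _) (Set.toFinite _)] at this
    exact lt_irrefl _ this
  let L : SlotSp M →ₗ[ℝ] ObsSp N :=
    (fderiv ℝ f 0).toLinearMap.comp (LinearMap.single ℝ (fun _ : Fin K => SlotSp M) k)
  have hL : Function.Injective L := 
    (hb 0).1.comp (Pi.single_injective (M := fun _ : Fin K => SlotSp M) k)
  by_cases hne : (Iset f 0 k).Nonempty
  · obtain ⟨n, hn⟩ := hne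
    have hinj : Function.Injective ((LinearMap.proj n).comp L : SlotSp M →ₗ[ℝ] ℝ) := by
      rw [injective_iff_map_eq_zero]
      intro v hv
      apply hL
      rw [map_zero]
      ext m
      by_cases hm : m ∈ Iset f 0 k
      · rw [hsub hm hn]; exact hv
      · simp only [Iset, mem_ofPred_eq, not_not] at hm
        exact congrFun hm v
    simpa using LinearMap.finrank_le_finrank_of_injective hinj
  · have hz : ∀ v, L v = 0 := by
      intro v
      ext m
      by_cases hm : m ∈ Iset f 0 k
      · exact absurd ⟨m, hm⟩ hne
      · simp only [Iset, mem_ofPred_eq, not_not] at hm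
        exact congrFun hm v
    have : Subsingleton (SlotSp M) := ⟨fun a b => hL (by rw [hz, hz])⟩
    have h := Module.finrank_zero_of_subsingleton (R := ℝ) (M := SlotSp M)
    simp at h
    omega

lemma row_single {K : ℕ} (L : LatSp K 1 →L[ℝ] ℝ)
    (hp : ∀ k j : Fin K, k ≠ j → L (Pi.single k (fun _ => 1)) = 0 ∨ L (Pi.single j (fun _ => 1)) = 0)
    (hne : ∃ d, L d ≠ 0) : ∃ i : Fin K, ∃ c : ℝ, c ≠ 0 ∧ ∀ d, L d = c * d i 0 := by
  have hsum : ∀ d, L d = ∑ l, d l 0 * L (Pi.single l (fun _ => 1)) := by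
    intro d
    have h1 : d = ∑ l, (d l 0) • (Pi.single l (fun _ => 1) : LatSp K 1) := by
      ext l m
      rw [Subsingleton.elim m 0]
      simp [Finset.sum_apply, Pi.single_apply, apply_ite (fun g : SlotSp 1 => g 0)]
    conv_lhs => rw [h1]
    simp [map_sum]
  obtain ⟨d0, hd0⟩ := hne
  obtain ⟨i, hi⟩ : ∃ i, L (Pi.single i (fun _ => 1)) ≠ 0 := by
    by_contra hcon
    push Not at hcon
    apply hd0
    rw [hsum]
    simp [hcon]
  refine ⟨i, _, hi, fun d => ?_⟩
  rw [hsum, Finset.sum_eq_single i, mul_comm]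
  · intro l _ hl
    rcases hp l i hl with h | h
    · simp [h]
    · exact absurd h hi
  · simp

lemma const_of_index {K : ℕ} (φ : LatSp K 1 → ℝ) (hφ : Differentiable ℝ φ) (i : Fin K)
    (H : ∀ z, ∃ c : ℝ, c ≠ 0 ∧ ∀ d, fderiv ℝ φ z d = c * d i 0) (z z' : LatSp K 1)
    (hz : z i = z' i) : φ z = φ z' := by
  have hder : ∀ s : ℝ, HasDerivAt (fun s : ℝ => φ (z + s • (z' - z))) 0 s := by
    intro s
    have h1 : HasDerivAt (fun s : ℝ => z + s • (z' - z)) (z' - z) s := by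
      simpa using ((hasDerivAt_id s).smul_const (z' - z)).const_add z
    have h2 := (hφ (z + s • (z' - z))).hasFDerivAt.comp_hasDerivAt s h1
    obtain ⟨c, -, hc⟩ := H (z + s • (z' - z))
    rw [hc] at h2
    have h3 : c * (z' - z) i 0 = 0 := by simp [hz]
    rw [h3] at h2
    exact h2
  have := is_const_of_deriv_eq_zero (fun s => (hder s).differentiableAt) (fun s => (hder s).deriv) 0 1
  simpa using this

lemma Ccomp_zero {K N : ℕ} (f : LatSp K 1 → ObsSp N) (z : LatSp K 1) (h : Ccomp f z = 0)
    (n : Fin N) (k j : Fin K) (hkj : k ≠ j) :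
    fderiv ℝ f z (Pi.single k (fun _ => 1)) n = 0 ∨ fderiv ℝ f z (Pi.single j (fun _ => 1)) n = 0 := by
  have key : ∀ k j : Fin K, k < j → fderiv ℝ f z (Pi.single k (fun _ => 1)) n = 0 ∨
      fderiv ℝ f z (Pi.single j (fun _ => 1)) n = 0 := by
    intro k j hlt
    have hnn : ∀ (n : Fin N) (k j : Fin K),
        0 ≤ if k < j then slotGradNorm f z n k * slotGradNorm f z n j else 0 := by
      intro n k j
      split_ifs
      · exact mul_nonneg (Real.sqrt_nonneg _) (Real.sqrt_nonneg _)
      · exact le_rfl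
    unfold Ccomp at h
    rw [Finset.sum_eq_zero_iff_of_nonneg
      (fun n _ => Finset.sum_nonneg fun k _ => Finset.sum_nonneg fun j _ => hnn n k j)] at h
    have h1 := h n (Finset.mem_univ _)
    rw [Finset.sum_eq_zero_iff_of_nonneg
      (fun k _ => Finset.sum_nonneg fun j _ => hnn n k j)] at h1
    have h2 := h1 k (Finset.mem_univ _)
    rw [Finset.sum_eq_zero_iff_of_nonneg (fun j _ => hnn n k j)] at h2
    have h3 := h2 j (Finset.mem_univ _)
    rw [if_pos hlt, mul_eq_zero] at h3
    have he : (Pi.single 0 1 : SlotSp 1) = fun _ => 1 := by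
      ext m; rw [Subsingleton.elim m 0]; simp
    have hg : ∀ l, slotGradNorm f z n l = 0 → fderiv ℝ f z (Pi.single l (fun _ => 1)) n = 0 := by
      intro l hl
      unfold slotGradNorm at hl
      rw [Fin.sum_univ_one, he, Real.sqrt_sq_eq_abs, abs_eq_zero] at hl
      exact hl
    exact h3.imp (hg k) (hg j)
  rcases lt_or_gt_of_ne hkj with h' | h'
  · exact key k j h'
  · exact (key j k h').symm

lemma comp_zero {K N : ℕ} (f : LatSp K 1 → ObsSp N) (z : LatSp K 1) (h : Compositional f)
    (n : Fin N) (k j : Fin K) (hkj : k ≠ j) :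
    fderiv ℝ f z (Pi.single k (fun _ => 1)) n = 0 ∨ fderiv ℝ f z (Pi.single j (fun _ => 1)) n = 0 := by
  by_contra hcon
  push Not at hcon
  have h1 := h z k j hkj
  have h2 : n ∈ Iset f z k ∩ Iset f z j :=
    ⟨fun h0 => hcon.1 (congrFun h0 _), fun h0 => hcon.2 (congrFun h0 _)⟩
  rw [h1] at h2
  exact h2

lemma row_prod {K N : ℕ} (A B : LatSp K 1 →L[ℝ] ObsSp N) (C : LatSp K 1 →L[ℝ] LatSp K 1)
    (hABC : ∀ d, B (C d) = A d) (hB : Function.Injective B) (hC : Function.Surjective C)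
    (hA' : ∀ n (k j : Fin K), k ≠ j → A (Pi.single k (fun _ => 1)) n = 0 ∨
      A (Pi.single j (fun _ => 1)) n = 0)
    (hB' : ∀ n (k j : Fin K), k ≠ j → B (Pi.single k (fun _ => 1)) n = 0 ∨
      B (Pi.single j (fun _ => 1)) n = 0) (j : Fin K) :
    ∃ i : Fin K, ∃ c : ℝ, c ≠ 0 ∧ ∀ d, C d j 0 = c * d i 0 := by
  have hone : (Pi.single j (fun _ => 1) : LatSp K 1) ≠ 0 := by
    intro h
    have := congrFun (congrFun h j) 0
    simp at this
  obtain ⟨n, hn⟩ : ∃ n, B (Pi.single j (fun _ => 1)) n ≠ 0 := by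
    by_contra hcon
    push Not at hcon
    apply hone
    apply hB
    rw [map_zero]
    ext n
    exact hcon n
  obtain ⟨i, c, hc, hi⟩ := row_single ((ContinuousLinearMap.proj n).comp B) (hB' n) ⟨_, hn⟩
  have hij : i = j := by
    by_contra hne
    apply hn
    have := hi (Pi.single j (fun _ => 1))
    simpa [Pi.single_apply, hne] using this
  subst hij
  have hAC : ∀ d, A d n = c * C d i 0 := by
    intro d
    rw [← hABC]
    exact hi (C d)
  refine row_single ((ContinuousLinearMap.proj (R := ℝ) (φ := fun _ : Fin 1 => ℝ) 0).comp
    ((ContinuousLinearMap.proj (R := ℝ) (φ := fun _ : Fin K => SlotSp 1) i).comp C)) ?_ ?_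
  · intro k l hkl
    have := hA' n k l hkl
    rw [hAC, hAC] at this
    simpa [hc] using this
  · obtain ⟨d, hd⟩ := hC (Pi.single i (fun _ => 1))
    refine ⟨d, ?_⟩
    simp [hd]

lemma main_one {K N : ℕ}
    (f : LatSp K 1 → ObsSp N) (hf : IsDiffeo f) (hb : ∀ z, Function.Bijective (fderiv ℝ f z))
    (hfc : Compositional f)
    (gHat : ObsSp N → LatSp K 1) (fHat : LatSp K 1 → ObsSp N)
    (hgdiff : Differentiable ℝ gHat) (hfhdiff : Differentiable ℝ fHat)
    (hrec : ∀ z : LatSp K 1, fHat (gHat (f z)) = f z)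
    (hcc : ∀ z : LatSp K 1, Ccomp fHat (gHat (f z)) = 0) :
    SlotIdentifies f gHat := by
  obtain ⟨hfd, g, hgd, hgl, hgr⟩ := hf
  obtain ⟨h, hh⟩ : ∃ h : LatSp K 1 → LatSp K 1, h = fun z => gHat (f z) := ⟨_, rfl⟩
  have hhz : ∀ z, gHat (f z) = h z := fun z => by rw [hh]
  simp only [hhz] at hrec hcc
  have hhd : Differentiable ℝ h := by rw [hh]; exact hgdiff.comp hfd
  have hchain : ∀ z d, fderiv ℝ fHat (h z) (fderiv ℝ h z d) = fderiv ℝ f z d := by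
    intro z d
    have h1 : f = fHat ∘ h := by ext1 z; exact (hrec z).symm
    conv_rhs => rw [h1, fderiv_comp z (hfhdiff _) (hhd z)]
    rfl
  have hCi : ∀ z, Function.Injective (fderiv ℝ h z) := fun z a b hab =>
    (hb z).1 (by rw [← hchain, ← hchain, hab])
  have hCs : ∀ z, Function.Surjective (fderiv ℝ h z) := fun z =>
    LinearMap.surjective_of_injective (f := (fderiv ℝ h z).toLinearMap) (hCi z)
  have hBi : ∀ z, Function.Injective (fderiv ℝ fHat (h z)) := by
    intro z a b hab
    obtain ⟨a, rfl⟩ := hCs z a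
    obtain ⟨b, rfl⟩ := hCs z b
    rw [hchain, hchain] at hab
    rw [(hb z).1 hab]
  -- surjectivity of h
  obtain ⟨r, hr⟩ : ∃ r : LatSp K 1 → LatSp K 1, r = fun w => g (fHat w) := ⟨_, rfl⟩
  have hrd : Differentiable ℝ r := by rw [hr]; exact hgd.comp hfhdiff
  have hrh : ∀ z, r (h z) = z := fun z => by rw [hr]; simp only [hrec]; exact hgl z
  have hhr : ∀ w, h (r w) = w := by
    apply surj_of_retract (fun w => h (r w)) (hhd.comp hrd).continuous
    · intro x; simp only [hrh]
    · intro x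
      have hz : r (h (r x)) = r x := hrh _
      have h1 : HasFDerivAt (h ∘ r) ((fderiv ℝ h (r x)).comp (fderiv ℝ r (h (r x)))) (h (r x)) := by
        apply HasFDerivAt.comp
        · rw [hz]; exact (hhd _).hasFDerivAt
        · exact (hrd _).hasFDerivAt
      have h2 : ∀ d, fderiv ℝ r (h (r x)) (fderiv ℝ h (r x) d) = d := by
        intro d
        have h3 : HasFDerivAt (r ∘ h) ((fderiv ℝ r (h (r x))).comp (fderiv ℝ h (r x))) (r x) :=
          HasFDerivAt.comp _ (hrd _).hasFDerivAt (hhd _).hasFDerivAt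
        have h4 : r ∘ h = id := by ext1 z; exact hrh z
        rw [h4] at h3
        have h5 := h3.unique (hasFDerivAt_id _)
        exact congrArg (fun L => L d) h5
      have h6 : (fderiv ℝ h (r x)).comp (fderiv ℝ r (h (r x))) = ContinuousLinearMap.id ℝ _ := by
        apply ContinuousLinearMap.ext
        intro d
        obtain ⟨d, rfl⟩ := hCs (r x) d
        simp [h2]
      rw [h6] at h1
      exact h1
  -- the permutation
  have hφd : ∀ j, Differentiable ℝ (fun z => h z j 0) := fun j => by fun_prop
  have hφf : ∀ j z d, fderiv ℝ (fun z => h z j 0) z d = fderiv ℝ h z d j 0 := by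
    intro j z d
    have h1 := ((ContinuousLinearMap.proj (R := ℝ) (φ := fun _ : Fin 1 => ℝ) 0).comp
      (ContinuousLinearMap.proj (R := ℝ) (φ := fun _ : Fin K => SlotSp 1) j)).hasFDerivAt.comp z
      (hhd z).hasFDerivAt
    exact congrArg (fun L => L d) h1.fderiv
  have hidx : ∀ j, ∃ i : Fin K, ∀ z, ∃ c : ℝ, c ≠ 0 ∧
      ∀ d, fderiv ℝ (fun z => h z j 0) z d = c * d i 0 := by
    intro j
    apply const_index _ (hφd j)
    intro z
    simp only [hφf]
    exact row_prod (fderiv ℝ f z) (fderiv ℝ fHat (h z)) (fderiv ℝ h z) (hchain z) (hBi z) (hCs z)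
      (comp_zero f z hfc) (Ccomp_zero fHat (h z) (hcc z)) j
  choose σ hσ using hidx
  have hdep : ∀ j z z', z (σ j) = z' (σ j) → h z j = h z' j := by
    intro j z z' hz
    ext m
    rw [Subsingleton.elim m 0]
    exact const_of_index _ (hφd j) (σ j) (hσ j) z z' hz
  have hσi : Function.Injective σ := by
    intro a b hab
    by_contra hne
    obtain ⟨c, hc, h1⟩ := hσ a 0
    obtain ⟨c', hc', h2⟩ := hσ b 0
    obtain ⟨d, hd⟩ := hCs 0 (Pi.single a (fun _ => 1))
    have h3 := h1 d
    have h4 := h2 d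
    rw [hφf, hd] at h3 h4
    rw [← hab] at h4
    simp [Pi.single_apply, Ne.symm hne, hc'] at h4
    simp [h4] at h3
  have hσs : Function.Surjective σ := Finite.surjective_of_injective hσi
  intro k
  obtain ⟨j, hj⟩ := hσs k
  have hsd : ∀ l : Fin K, Differentiable ℝ (fun x : SlotSp 1 => (Pi.single l x : LatSp K 1)) :=
    fun l => (ContinuousLinearMap.single ℝ (fun _ : Fin K => SlotSp 1) l).differentiable
  have hHinj : ∀ x x' : SlotSp 1, h (Pi.single k x) j = h (Pi.single k x') j → x = x' := by
    intro x x' hx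
    have h1 : h (Pi.single k x) = h (Pi.single k x') := by
      ext1 l
      by_cases hl : l = j
      · rw [hl]; exact hx
      · apply hdep
        have : σ l ≠ k := fun h0 => hl (hσi (h0.trans hj.symm))
        simp [Pi.single_apply, this]
    have h2 := congrArg r h1
    rw [hrh, hrh] at h2
    exact Pi.single_injective k h2
  have hHz : ∀ z, h z j = h (Pi.single k (z k)) j := by
    intro z
    apply hdep
    rw [hj]; simp
  have hHr : ∀ y : SlotSp 1, h (Pi.single k (r (Pi.single j y) k)) j = y := by
    intro y
    rw [← hHz, hhr]; simp
  refine ⟨j, ⟨fun x => h (Pi.single k x) j, ⟨?_, fun y => r (Pi.single j y) k, ?_, ?_, ?_⟩, ?_⟩, ?_⟩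
  · exact differentiable_pi.1 (hhd.comp (hsd k)) j
  · exact differentiable_pi.1 (hrd.comp (hsd j)) k
  · intro x
    exact hHinj _ _ (hHr _)
  · intro y
    exact hHr y
  · intro z
    rw [hhz]; exact hHz z
  · rintro j' ⟨h', ⟨-, g', -, hg', -⟩, hz'⟩
    by_contra hne
    have hne' : σ j' ≠ k := fun h0 => hne (hσi (h0.trans hj.symm))
    have h1 : h (Pi.single k (fun _ => 1)) j' = h 0 j' := by
      apply hdep
      simp [Pi.single_apply, hne']
    rw [← hhz, ← hhz, hz', hz'] at h1
    have h2 := congrFun (hg'.injective h1) 0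
    simp at h2

/-- **Theorem 2 (Slot identifiability via the compositional contrast).** If `f` is a
compositional, irreducible diffeomorphism and the differentiable encoder/decoder pair
`(gHat, fHat)` achieves zero reconstruction error and zero compositional contrast on
every data point `f z`, then `gHat` slot-identifies `z`. -/
theorem slot_identifiability_contrast {K M N : ℕ} (hK : 1 ≤ K) (hM : 1 ≤ M) (hN : 1 ≤ N)
    (f : LatSp K M → ObsSp N) (hf : IsDiffeo f)
    (hfc : Compositional f) (hfi : IrreducibleMech f)
    (gHat : ObsSp N → LatSp K M) (fHat : LatSp K M → ObsSp N)
    (hgdiff : Differentiable ℝ gHat) (hfhdiff : Differentiable ℝ fHat)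
    (hrec : ∀ z : LatSp K M, fHat (gHat (f z)) = f z)
    (hcc : ∀ z : LatSp K M, Ccomp fHat (gHat (f z)) = 0) :
    SlotIdentifies f gHat := by
  have hb : ∀ z, Function.Bijective (fderiv ℝ f z) := by
    intro z
    obtain ⟨hfd, g, hgd, hgl, hgr⟩ := hf
    have h1 : ∀ d, fderiv ℝ g (f z) (fderiv ℝ f z d) = d := by
      intro d
      have h3 : HasFDerivAt (g ∘ f) ((fderiv ℝ g (f z)).comp (fderiv ℝ f z)) z :=
        HasFDerivAt.comp _ (hgd _).hasFDerivAt (hfd _).hasFDerivAt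
      rw [hgl.comp_eq_id] at h3
      exact congrArg (fun L => L d) (h3.unique (hasFDerivAt_id _))
    have h2 : ∀ d, fderiv ℝ f z (fderiv ℝ g (f z) d) = d := by
      intro d
      have h3 : HasFDerivAt (f ∘ g) ((fderiv ℝ f (g (f z))).comp (fderiv ℝ g (f z))) (f z) :=
        HasFDerivAt.comp _ (hfd _).hasFDerivAt (hgd _).hasFDerivAt
      rw [hgr.comp_eq_id, hgl z] at h3
      exact congrArg (fun L => L d) (h3.unique (hasFDerivAt_id _))
    exact ⟨Function.LeftInverse.injective h1, Function.RightInverse.surjective h2⟩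
  have hM1 : M = 1 := le_antisymm (M_le_one hK f hfi hb) hM
  subst hM1
  exact main_one f hf hb hfc gHat fHat hgdiff hfhdiff hrec hcc
end

section
/- Let f : Z → X be a diffeomorphism that is compositional, and let S1, S2 ⊆ [N] be nonempty. For every z ∈ Z and k ∈ [K], if S1 ⊆ I_k(z) and S2 ∩ I_k(z) = ∅, then the sub-mechanisms Jf_{S1}(z) and Jf_{S2}(z) are independent, i.e., rank(Jf_{S1∪S2}(z)) = rank(Jf_{S1}(z)) + rank(Jf_{S2}(z)). -/
open Function Set

theorem finrank_submodule_prod_aux {E F : Type*} [AddCommGroup E] [Module ℝ E]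
    [AddCommGroup F] [Module ℝ F] [FiniteDimensional ℝ E] [FiniteDimensional ℝ F]
    (p : Submodule ℝ E) (q : Submodule ℝ F) :
    Module.finrank ℝ (p.prod q) = Module.finrank ℝ p + Module.finrank ℝ q := by
  have e : (p.prod q) ≃ₗ[ℝ] (p × q) :=
    { toFun := fun x => (⟨x.1.1, x.2.1⟩, ⟨x.1.2, x.2.2⟩)
      invFun := fun x => ⟨(x.1.1, x.2.1), x.1.2, x.2.2⟩
      map_add' := fun _ _ => rfl
      map_smul' := fun _ _ => rfl
      left_inv := fun _ => rfl
      right_inv := fun _ => rfl }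
  rw [e.finrank_eq, Module.finrank_prod]

/-- **Lemma 1.** Sub-mechanisms of distinct mechanisms are independent. -/
theorem indep_submech_of_distinct {K M N : ℕ} (hK : 1 ≤ K) (hM : 1 ≤ M) (hN : 1 ≤ N)
    (f : LatSp K M → ObsSp N) (hf : IsDiffeo f) (hfc : Compositional f)
    (S1 S2 : Set (Fin N)) (hS1 : S1.Nonempty) (hS2 : S2.Nonempty) :
    ∀ (z : LatSp K M) (k : Fin K), S1 ⊆ Iset f z k → S2 ∩ Iset f z k = ∅ →
      IndepSub f z S1 S2 := by
  intro z k h1 h2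
  unfold IndepSub jacRank
  set A : LatSp K M →ₗ[ℝ] ObsSp N := (fderiv ℝ f z).toLinearMap with hA
  have hA1 : ∀ n ∈ S1, ∀ v : LatSp K M, v k = 0 → A v n = 0 := by
    intro n hn v hv
    have hsum : v = ∑ j, Pi.single j (v j) := (Finset.univ_sum_single v).symm
    rw [hsum, map_sum, Finset.sum_apply]
    refine Finset.sum_eq_zero fun j _ => ?_
    by_cases hj : j = k
    · subst hj
      simp [hv]
    · by_contra hne
      have hmem : n ∈ Iset f z k ∩ Iset f z j := by
        refine ⟨h1 hn, fun h0 => hne ?_⟩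
        exact congrFun h0 (v j)
      rw [hfc z k j (Ne.symm hj)] at hmem
      exact hmem
  have hA2 : ∀ n ∈ S2, ∀ w : SlotSp M, A (Pi.single k w) n = 0 := by
    intro n hn w
    by_contra hne
    have hmem : n ∈ S2 ∩ Iset f z k := ⟨hn, fun h0 => hne (congrFun h0 w)⟩
    rw [h2] at hmem
    exact hmem
  let φ : ((S1 ∪ S2 : Set (Fin N)) → ℝ) →ₗ[ℝ] ((S1 → ℝ) × (S2 → ℝ)) :=
    (LinearMap.funLeft ℝ ℝ (Set.inclusion Set.subset_union_left)).prod
      (LinearMap.funLeft ℝ ℝ (Set.inclusion Set.subset_union_right))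
  have hφ : Function.Injective φ := by
    intro x y hxy
    obtain ⟨hx1, hx2⟩ := Prod.ext_iff.mp hxy
    funext n
    obtain ⟨n, hn | hn⟩ := n
    · exact congrFun hx1 ⟨n, hn⟩
    · exact congrFun hx2 ⟨n, hn⟩
  have hmap : (LinearMap.range ((LinearMap.funLeft ℝ ℝ
      ((↑) : (S1 ∪ S2 : Set (Fin N)) → Fin N)).comp A)).map φ =
      (LinearMap.range ((LinearMap.funLeft ℝ ℝ ((↑) : S1 → Fin N)).comp A)).prod
      (LinearMap.range ((LinearMap.funLeft ℝ ℝ ((↑) : S2 → Fin N)).comp A)) := by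
    ext ⟨x, y⟩
    constructor
    · rintro ⟨_, ⟨v, rfl⟩, hv⟩
      obtain ⟨hx, hy⟩ := Prod.ext_iff.mp hv
      exact ⟨⟨v, hx⟩, ⟨v, hy⟩⟩
    · rintro ⟨⟨a, ha⟩, ⟨b, hb⟩⟩
      refine ⟨_, ⟨Pi.single k (a k - b k) + b, rfl⟩, ?_⟩
      refine Prod.ext ?_ ?_
      · change _ = (x, y).1
        rw [← ha]
        funext n
        change A (Pi.single k (a k - b k) + b) n = A a n
        have := hA1 n n.2 (Pi.single k (a k - b k) + b - a) (by simp)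
        rw [map_sub, Pi.sub_apply] at this
        linarith
      · change _ = (x, y).2
        rw [← hb]
        funext n
        change A (Pi.single k (a k - b k) + b) n = A b n
        rw [map_add, Pi.add_apply, hA2 n n.2, zero_add]
  rw [(Submodule.equivMapOfInjective φ hφ _).finrank_eq, hmap,
    finrank_submodule_prod_aux]
end
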